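/- arXiv:2511.20368 — 2 statements merged into one kernel-verified Lean document; each statement's English description precedes it below -/
import Mathlib

section
/- Let n ≥ 1 and let G be a finite simple graph on the vertex set {x₁,…,xₙ} ∪ {y₁,…,yₙ} (disjoint union of two parts of size n) in which every edge joins some xᵢ to some yⱼ. Assume that every cycle of G has length congruent to 2 modulo 4. Let σ and τ be permutations of {1,…,n} such that xᵢ is adjacent to y_{σ(i)} for every i, and xᵢ is adjacent to y_{τ(i)} for every i (i.e., σ and τ encode two perfect matchings of G). Then σ and τ have the same sign. -/
open Equiv.Perm in
/-- If `xᵢ` is adjacent to `y_{σ i}` and to `y_{τ i}` for all `i`, then a cycle of `τ⁻¹ * σ` of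
length `k` gives an alternating closed walk of length `2 * k` without repeated vertices. -/
theorem exists_isCycle_length_eq_two_mul {α : Type*} [Fintype α] [DecidableEq α]
    {G : SimpleGraph (α ⊕ α)} {σ τ : Equiv.Perm α}
    (hσ : ∀ i, G.Adj (Sum.inl i) (Sum.inr (σ i)))
    (hτ : ∀ i, G.Adj (Sum.inl i) (Sum.inr (τ i)))
    {k : ℕ} (hk : k ∈ (τ⁻¹ * σ).cycleType) :
    ∃ (v : α ⊕ α) (c : G.Walk v v), c.IsCycle ∧ c.length = 2 * k := by
  have hk2 : 2 ≤ k := two_le_of_mem_cycleType hk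
  simp only [cycleType_def, Multiset.mem_map, Finset.mem_val, Function.comp_apply] at hk
  obtain ⟨c, hcf, hck⟩ := hk
  have hc : c.IsCycle := (mem_cycleFactorsFinset_iff.1 hcf).1
  generalize hπ : τ⁻¹ * σ = π at *
  obtain ⟨i, hi⟩ := hc.nonempty_support
  have hcyc : π.IsCycleOn c.support := by
    rw [cycle_is_cycleOf hi hcf]
    exact isCycleOn_support_cycleOf π i
  have hmod : ∀ a b : ℕ, (π ^ a) i = (π ^ b) i ↔ a ≡ b [MOD k] := fun a b => by
    rw [← hck]; exact hcyc.pow_apply_eq_pow_apply hi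
  have hτπ : ∀ j, τ (π j) = σ j := fun j => by simp [← hπ]
  let g : ℕ → α ⊕ α := fun m =>
    if m % 2 = 0 then Sum.inl ((π ^ (m / 2)) i) else Sum.inr (σ ((π ^ (m / 2)) i))
  have hadj : ∀ m, G.Adj (g m) (g (m + 1)) := fun m => by
    rcases Nat.even_or_odd' m with ⟨j, rfl | rfl⟩
    · have h1 : (2 * j + 1) / 2 = j := by omega
      simpa [g, h1] using hσ _
    · have h1 : (2 * j + 1) / 2 = j := by omega
      have h2 : (2 * j + 1 + 1) / 2 = j + 1 := by omega
      have h3 : (2 * j + 1 + 1) % 2 = 0 := by omega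
      have h4 := (hτ (π ((π ^ j) i))).symm
      rw [hτπ] at h4
      simpa [g, h1, h2, h3, pow_succ'] using h4
  have hper : g (2 * k) = g 0 := by
    have := (hmod k 0).2 (by simp [Nat.ModEq])
    simpa [g] using this
  have hinj : ∀ a b, a < 2 * k → b < 2 * k → g a = g b → a = b := fun a b ha hb h => by
    have key : (π ^ (a / 2)) i = (π ^ (b / 2)) i → a / 2 = b / 2 := fun h =>
      ((hmod _ _).1 h).eq_of_lt_of_lt (by omega) (by omega)
    by_cases h1 : a % 2 = 0 <;> by_cases h2 : b % 2 = 0 <;> simp [g, h1, h2] at h <;>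
      have := key h <;> omega
  have hsub : ∀ u v : Fin (2 * k), (u - v).val = 1 → G.Adj (g v) (g u) := fun u v h => by
    have hu := u.isLt
    have hv := v.isLt
    rw [Fin.sub_def] at h
    simp only at h
    rcases Nat.lt_or_ge v.val u.val with hlt | hge
    · have h5 : 2 * k - v.val + u.val = 2 * k + (u.val - v.val) := by omega
      rw [h5, Nat.add_mod_left, Nat.mod_eq_of_lt (by omega)] at h
      have h6 : u.val = v.val + 1 := by omega
      rw [h6]; exact hadj _
    · rcases hge.eq_or_lt with heq | hlt
      · have h5 : 2 * k - v.val + u.val = 2 * k := by omega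
        rw [h5, Nat.mod_self] at h
        omega
      · rw [Nat.mod_eq_of_lt (by omega)] at h
        have h6 : v.val + 1 = 2 * k := by omega
        have h7 : u.val = 0 := by omega
        have h8 := hadj v.val
        rwa [h6, hper, ← h7] at h8
  refine (SimpleGraph.cycleGraph_isContained_iff (by omega)).1
    ⟨⟨⟨fun u => g u, fun {u v} h => ?_⟩, fun u v h => Fin.ext (hinj _ _ u.isLt v.isLt h)⟩⟩
  rcases SimpleGraph.cycleGraph_adj'.1 h with h | h
  · exact (hsub _ _ h).symm
  · exact hsub _ _ h


/-- Let `G` be a bipartite simple graph on `Fin n ⊕ Fin n` (every edge joins a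
left vertex to a right vertex) in which every cycle has length `≡ 2 (mod 4)`.
If `σ` and `τ` are permutations of `Fin n` encoding perfect matchings of `G`
(i.e. `xᵢ` is adjacent to `y_{σ i}` and to `y_{τ i}` for all `i`), then `σ`
and `τ` have the same sign. -/
theorem perm_sign_eq_of_matchings_of_cycles_two_mod_four
    (n : ℕ) (hn : 1 ≤ n) (G : SimpleGraph (Fin n ⊕ Fin n))
    (hbip : ∀ u v : Fin n ⊕ Fin n, G.Adj u v →
      ((∃ i, u = Sum.inl i) ∧ (∃ j, v = Sum.inr j)) ∨
      ((∃ j, u = Sum.inr j) ∧ (∃ i, v = Sum.inl i)))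
    (hcyc : ∀ (v : Fin n ⊕ Fin n) (c : G.Walk v v), c.IsCycle →
      c.length % 4 = 2)
    (σ τ : Equiv.Perm (Fin n))
    (hσ : ∀ i, G.Adj (Sum.inl i) (Sum.inr (σ i)))
    (hτ : ∀ i, G.Adj (Sum.inl i) (Sum.inr (τ i))) :
    Equiv.Perm.sign σ = Equiv.Perm.sign τ := by
  have h : Equiv.Perm.sign (τ⁻¹ * σ) = 1 := by
    rw [Equiv.Perm.sign_of_cycleType']
    refine Multiset.prod_eq_one fun x hx => ?_
    obtain ⟨k, hk, rfl⟩ := Multiset.mem_map.1 hx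
    obtain ⟨v, c, hc, hl⟩ := exists_isCycle_length_eq_two_mul hσ hτ hk
    have hmod := hcyc v c hc
    have hodd : Odd k := Nat.odd_iff.2 (by omega)
    simp [hodd.neg_one_pow]
  rw [map_mul, Equiv.Perm.sign_inv] at h
  rw [← mul_right_inj (Equiv.Perm.sign τ), h, Int.units_mul_self]
end

section
/- Let n ≥ 1 and let G be a finite simple graph on the vertex set {x₁,…,xₙ} ∪ {y₁,…,yₙ} in which every edge joins some xᵢ to some yⱼ. Assume that (a) every cycle of G has length congruent to 2 modulo 4, and (b) G has at least one perfect matching, i.e., there exists a permutation σ of {1,…,n} with xᵢ adjacent to y_{σ(i)} for every i. Define the n-by-n biadjacency matrix M by M(i,j) = 1 if xᵢ is adjacent to yⱼ and M(i,j) = 0 otherwise. Then det(M) ≠ 0. -/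
/-- A closed sequence of `n ≥ 3` distinct, consecutively adjacent vertices yields a cycle. -/
theorem SimpleGraph.exists_isCycle_of_injOn {V : Type*} {G : SimpleGraph V} {n : ℕ} (hn : 2 < n)
    (g : ℕ → V) (hinj : Set.InjOn g (Set.Iio n)) (hadj : ∀ m, G.Adj (g m) (g (m + 1)))
    (hclosed : g n = g 0) :
    ∃ (v : V) (p : G.Walk v v), p.IsCycle ∧ p.length = n := by
  refine (cycleGraph_isContained_iff hn).mp
    ⟨⟨⟨fun m ↦ g m, ?_⟩, fun a b h ↦ Fin.ext (hinj a.isLt b.isLt h)⟩⟩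
  intro a b hab
  wlog h : (b - a).val = 1 generalizing a b
  · exact (this hab.symm ((cycleGraph_adj'.mp hab).resolve_right h)).symm
  rcases le_or_gt a b with hle | hlt
  · rw [Fin.coe_sub_iff_le.mpr hle] at h
    have : b.val = a.val + 1 := by omega
    simpa only [this] using hadj a
  · rw [Fin.coe_sub_iff_lt.mpr hlt] at h
    have ha : a.val + 1 = n := by omega
    have hb : b.val = 0 := by omega
    have := hadj a
    rw [ha, hclosed] at this
    simpa only [hb] using this

/-- Interleaving two perfect matchings `σ`, `τ` along a cycle of `σ⁻¹ * τ` with support of size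
`k` gives a cycle of length `2 * k` in the graph. -/
theorem SimpleGraph.exists_isCycle_of_mem_cycleFactorsFinset {α : Type*} [Fintype α]
    [DecidableEq α] {G : SimpleGraph (α ⊕ α)} {σ τ c : Equiv.Perm α}
    (hσ : ∀ i, G.Adj (Sum.inl i) (Sum.inr (σ i)))
    (hτ : ∀ i, G.Adj (Sum.inl i) (Sum.inr (τ i)))
    (hc : c ∈ (σ⁻¹ * τ).cycleFactorsFinset) :
    ∃ (v : α ⊕ α) (p : G.Walk v v), p.IsCycle ∧ p.length = 2 * c.support.card := by
  obtain ⟨hcycle, happly⟩ := Equiv.Perm.mem_cycleFactorsFinset_iff.mp hc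
  obtain ⟨i, hi⟩ := hcycle.nonempty_support
  have htwo := hcycle.two_le_card_support
  have hpow : Set.InjOn (fun m ↦ (c ^ m) i) (Set.Iio c.support.card) := by
    intro a ha b hb hab
    rw [← hcycle.orderOf] at ha hb
    exact pow_injOn_Iio_orderOf ha hb
      (hcycle.pow_eq_pow_iff.mpr ⟨i, Equiv.Perm.mem_support.mp hi, hab⟩)
  have hstep (m : ℕ) : σ ((c ^ (m + 1)) i) = τ ((c ^ m) i) := by
    rw [pow_succ', Equiv.Perm.mul_apply, happly _ (Equiv.Perm.pow_apply_mem_support.mpr hi)]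
    simp
  refine exists_isCycle_of_injOn (by omega)
    (fun m ↦ if Even m then Sum.inl ((c ^ (m / 2)) i) else Sum.inr (τ ((c ^ (m / 2)) i)))
    ?_ ?_ ?_
  · intro a ha b hb hab
    simp only [Set.mem_Iio] at ha hb
    have key : (c ^ (a / 2)) i = (c ^ (b / 2)) i → a / 2 = b / 2 := fun h ↦
      hpow (Set.mem_Iio.mpr (by omega)) (Set.mem_Iio.mpr (by omega)) h
    dsimp only at hab
    split_ifs at hab with h₁ h₂ h₂
    · have := key (Sum.inl.inj hab)
      grind
    · have := key (τ.injective (Sum.inr.inj hab))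
      grind
  · intro m
    rcases Nat.even_or_odd' m with ⟨k, rfl | rfl⟩
    · have h : (2 * k + 1) / 2 = k := by omega
      simpa [h] using hτ ((c ^ k) i)
    · have h : (2 * k + 1) / 2 = k := by omega
      have h' : (2 * k + 1 + 1) / 2 = k + 1 := by omega
      have he : Even (2 * k + 1 + 1) := ⟨k + 1, by omega⟩
      simpa [h, h', he, hstep] using (hσ ((c ^ (k + 1)) i)).symm
  · simp [← hcycle.orderOf, pow_orderOf_eq_one]

/-- A permutation all of whose cycles have odd length is even. -/
theorem Equiv.Perm.sign_eq_one_of_odd_cycleType {α : Type*} [Fintype α] [DecidableEq α]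
    {π : Equiv.Perm α} (h : ∀ k ∈ π.cycleType, Odd k) : π.sign = 1 := by
  rw [Equiv.Perm.sign_of_cycleType']
  refine Multiset.prod_eq_one fun x hx ↦ ?_
  obtain ⟨k, hk, rfl⟩ := Multiset.mem_map.mp hx
  simp [(h k hk).neg_one_pow]

/-- If all cycles have length `≡ 2 (mod 4)`, all perfect matchings have the same sign. -/
theorem SimpleGraph.sign_eq_of_matchings {α : Type*} [Fintype α] [DecidableEq α]
    {G : SimpleGraph (α ⊕ α)}
    (hcyc : ∀ (v : α ⊕ α) (c : G.Walk v v), c.IsCycle → c.length % 4 = 2)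
    {σ τ : Equiv.Perm α}
    (hσ : ∀ i, G.Adj (Sum.inl i) (Sum.inr (σ i)))
    (hτ : ∀ i, G.Adj (Sum.inl i) (Sum.inr (τ i))) :
    σ.sign = τ.sign := by
  have h : (σ⁻¹ * τ).sign = 1 := by
    refine Equiv.Perm.sign_eq_one_of_odd_cycleType fun k hk ↦ ?_
    rw [Equiv.Perm.cycleType_def] at hk
    obtain ⟨c, hc, rfl⟩ := Multiset.mem_map.mp hk
    obtain ⟨v, p, hp, hlen⟩ := exists_isCycle_of_mem_cycleFactorsFinset hσ hτ hc
    have := hcyc v p hp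
    rw [Function.comp_apply, Nat.odd_iff]
    omega
  rwa [map_mul, map_inv, inv_mul_eq_one] at h

open scoped Classical

/-- Let `G` be a bipartite simple graph on `Fin n ⊕ Fin n` (every edge joins a
left vertex to a right vertex), in which every cycle has length `≡ 2 (mod 4)`,
and which admits a perfect matching (encoded by a permutation `σ` with
`xᵢ` adjacent to `y_{σ i}` for all `i`). Then the biadjacency matrix of `G`
has nonzero determinant. -/
theorem det_biadjacency_ne_zero
    (n : ℕ) (hn : 1 ≤ n) (G : SimpleGraph (Fin n ⊕ Fin n))
    (hbip : ∀ u v : Fin n ⊕ Fin n, G.Adj u v →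
      ((∃ i, u = Sum.inl i) ∧ (∃ j, v = Sum.inr j)) ∨
      ((∃ j, u = Sum.inr j) ∧ (∃ i, v = Sum.inl i)))
    (hcyc : ∀ (v : Fin n ⊕ Fin n) (c : G.Walk v v), c.IsCycle →
      c.length % 4 = 2)
    (hmatch : ∃ σ : Equiv.Perm (Fin n),
      ∀ i, G.Adj (Sum.inl i) (Sum.inr (σ i)))
    (M : Matrix (Fin n) (Fin n) ℝ)
    (hMdef : ∀ i j, M i j = if G.Adj (Sum.inl i) (Sum.inr j) then 1 else 0) :
    M.det ≠ 0 := by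
  obtain ⟨σ, hσ⟩ := hmatch
  have hnonneg (τ : Equiv.Perm (Fin n)) : 0 ≤ ∏ i, M i (τ i) :=
    Finset.prod_nonneg fun i _ ↦ by rw [hMdef]; split_ifs <;> norm_num
  have hdet : M.det = σ.sign • ∑ τ : Equiv.Perm (Fin n), ∏ i, M i (τ i) := by
    rw [← Matrix.det_transpose, Matrix.det_apply, Finset.smul_sum]
    refine Finset.sum_congr rfl fun τ _ ↦ ?_
    simp only [Matrix.transpose_apply]
    by_cases hτ : ∀ i, G.Adj (Sum.inl i) (Sum.inr (τ i))
    · rw [SimpleGraph.sign_eq_of_matchings hcyc hσ hτ]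
    · obtain ⟨i, hi⟩ := not_forall.mp hτ
      have : ∏ i, M i (τ i) = 0 :=
        Finset.prod_eq_zero (Finset.mem_univ i) (by rw [hMdef, if_neg hi])
      rw [this, smul_zero, smul_zero]
  have hpos : 0 < ∑ τ : Equiv.Perm (Fin n), ∏ i, M i (τ i) :=
    Finset.sum_pos' (fun τ _ ↦ hnonneg τ) ⟨σ, Finset.mem_univ σ, by simp [hMdef, hσ]⟩
  rw [hdet, Ne, smul_eq_zero_iff_eq]
  exact hpos.ne'
end
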